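/- Assume Ψ satisfies the SOSC with feasible open set O, let s be the similarity dimension, let μ be the natural measure, and assume μ(∂O) = 0 (a known property under the SOSC). Then sup{θ_μ^s(x, d) : x ∈ E, d > 0} = sup{θ_μ^s(x, d) : x ∈ E, d > 0, B(x, d) ⊆ O}; that is, the supremum of s-densities of μ over all balls centred in E equals the supremum over typical balls contained in O. -/

import Mathlib

open MeasureTheory Filter Topology
open scoped ENNReal

noncomputable section

/-- `f` is a similarity of ratio `r`. -/
def IsSimilarityRatio {X : Type*} [MetricSpace X] (f : X → X) (r : ℝ) : Prop :=
  ∀ x y, dist (f x) (f y) = r * dist x y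

/-- The `s`-density `θ_μ^s(x, d) = μ(B(x,d)) / (2d)^s` of the closed ball `B(x, d)`. -/
def sdens {n : ℕ} (μ : Measure (EuclideanSpace ℝ (Fin n))) (s : ℝ)
    (x : EuclideanSpace ℝ (Fin n)) (d : ℝ) : ℝ≥0∞ :=
  μ (Metric.closedBall x d) / ENNReal.ofReal ((2 * d) ^ s)

theorem IsSimilarityRatio.comp {X : Type*} [MetricSpace X] {f g : X → X} {r ρ : ℝ}
    (hf : IsSimilarityRatio f r) (hg : IsSimilarityRatio g ρ) :
    IsSimilarityRatio (f ∘ g) (r * ρ) := fun x y => by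
  simp only [Function.comp_apply, hf _ _, hg _ _, mul_assoc]

theorem IsSimilarityRatio.continuous {X : Type*} [MetricSpace X] {f : X → X} {r : ℝ}
    (hf : IsSimilarityRatio f r) : Continuous f :=
  (LipschitzWith.of_dist_le' fun x y => (hf x y).le).continuous

/-- The preimage under a similarity of the image ball is the original ball. -/
theorem IsSimilarityRatio.preimage_closedBall {X : Type*} [MetricSpace X] {f : X → X} {r : ℝ}
    (hf : IsSimilarityRatio f r) (hr : 0 < r) (x : X) (d : ℝ) :
    f ⁻¹' Metric.closedBall (f x) (r * d) = Metric.closedBall x d := by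
  ext y
  simp [hf y x, hr]

/-- The density of an invariant measure does not decrease when a ball is replaced by its image
under one of the similarities. -/
theorem sdens_le_sdens_image {n m : ℕ}
    {f : Fin m → EuclideanSpace ℝ (Fin n) → EuclideanSpace ℝ (Fin n)} {r : Fin m → ℝ}
    (hr : ∀ i, 0 < r i) (hsim : ∀ i, IsSimilarityRatio (f i) (r i)) {s : ℝ}
    {μ : Measure (EuclideanSpace ℝ (Fin n))}
    (hinv : μ = ∑ i, ENNReal.ofReal ((r i) ^ s) • μ.map (f i))
    (i : Fin m) (x : EuclideanSpace ℝ (Fin n)) {d : ℝ} (hd : 0 < d) :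
    sdens μ s x d ≤ sdens μ s (f i x) (r i * d) := by
  have hle : ENNReal.ofReal ((r i) ^ s) * μ (Metric.closedBall x d) ≤
      μ (Metric.closedBall (f i x) (r i * d)) := by
    conv_rhs => rw [hinv]
    rw [Measure.finsetSum_apply]
    refine le_trans (le_of_eq ?_) (Finset.single_le_sum (fun _ _ => zero_le) (Finset.mem_univ i))
    rw [Measure.smul_apply, Measure.map_apply (hsim i).continuous.measurable
      Metric.isClosed_closedBall.measurableSet, (hsim i).preimage_closedBall (hr i), smul_eq_mul]
  have hpos : 0 < (r i) ^ s := Real.rpow_pos_of_pos (hr i) s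
  have hden : ENNReal.ofReal ((2 * (r i * d)) ^ s) =
      ENNReal.ofReal ((r i) ^ s) * ENNReal.ofReal ((2 * d) ^ s) := by
    rw [← ENNReal.ofReal_mul hpos.le, ← Real.mul_rpow (hr i).le (by positivity)]
    congr 2
    ring
  unfold sdens
  rw [hden, ← ENNReal.mul_div_mul_left _ _ (ENNReal.ofReal_pos.2 hpos).ne' ENNReal.ofReal_ne_top]
  gcongr

/-- Every point of the attractor lies in arbitrarily small similar copies of the attractor, along
which the density of the invariant measure does not decrease. -/
theorem exists_small_copy_sdens_le {n m : ℕ}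
    {f : Fin m → EuclideanSpace ℝ (Fin n) → EuclideanSpace ℝ (Fin n)} {r : Fin m → ℝ}
    (hr : ∀ i, 0 < r i) (hsim : ∀ i, IsSimilarityRatio (f i) (r i))
    {E : Set (EuclideanSpace ℝ (Fin n))} (hE : E = ⋃ i, f i '' E) {s : ℝ}
    {μ : Measure (EuclideanSpace ℝ (Fin n))}
    (hinv : μ = ∑ i, ENNReal.ofReal ((r i) ^ s) • μ.map (f i))
    {R : ℝ} (hR : ∀ i, r i ≤ R) (k : ℕ) :
    ∀ z ∈ E, ∃ (g : EuclideanSpace ℝ (Fin n) → EuclideanSpace ℝ (Fin n)) (ρ : ℝ),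
      0 < ρ ∧ ρ ≤ R ^ k ∧ IsSimilarityRatio g ρ ∧ Set.MapsTo g E E ∧ z ∈ g '' E ∧
      ∀ x d, 0 < d → sdens μ s x d ≤ sdens μ s (g x) (ρ * d) := by
  induction k with
  | zero =>
    exact fun z hz => ⟨id, 1, one_pos, by simp, fun x y => by simp, Set.mapsTo_id E, by simpa,
      fun x d _ => by simp⟩
  | succ k ih =>
    intro z hz
    rw [hE] at hz
    obtain ⟨i, y, hy, rfl⟩ := Set.mem_iUnion.1 hz
    obtain ⟨g, ρ, hρ, hρR, hg, hgE, ⟨w, hw, rfl⟩, hdens⟩ := ih y hy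
    refine ⟨f i ∘ g, r i * ρ, mul_pos (hr i) hρ, ?_, (hsim i).comp hg, fun x hx => ?_,
      ⟨w, hw, rfl⟩, fun x d hd => ?_⟩
    · rw [pow_succ']
      exact mul_le_mul (hR i) hρR hρ.le ((hr i).le.trans (hR i))
    · rw [hE]
      exact Set.mem_iUnion.2 ⟨i, g x, hgE hx, rfl⟩
    · rw [mul_assoc]
      exact (hdens x d hd).trans (sdens_le_sdens_image hr hsim hinv i (g x) (mul_pos hρ hd))

/-- under the SOSC, the supremum of the `s`-densities of the natural
measure over all balls centred in `E` equals the supremum over typical balls `⊆ O`. -/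
theorem stmt8 {n m : ℕ} (hn : 1 ≤ n) (hm : 2 ≤ m)
    (f : Fin m → EuclideanSpace ℝ (Fin n) → EuclideanSpace ℝ (Fin n))
    (r : Fin m → ℝ) (hr : ∀ i, r i ∈ Set.Ioo (0 : ℝ) 1)
    (hsim : ∀ i, IsSimilarityRatio (f i) (r i))
    (E : Set (EuclideanSpace ℝ (Fin n))) (hEcomp : IsCompact E) (hEne : E.Nonempty)
    (hEattr : E = ⋃ i, f i '' E)
    (O : Set (EuclideanSpace ℝ (Fin n))) (hOopen : IsOpen O) (hOne : O.Nonempty)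
    (hOmap : ∀ i, f i '' O ⊆ O)
    (hOdisj : ∀ i j, i ≠ j → Disjoint (f i '' O) (f j '' O))
    (hOE : (O ∩ E).Nonempty)
    (s : ℝ) (hs : ∑ i, (r i) ^ s = 1)
    (μ : Measure (EuclideanSpace ℝ (Fin n))) (hprob : IsProbabilityMeasure μ)
    (hsupp : μ Eᶜ = 0)
    (hinv : μ = ∑ i, ENNReal.ofReal ((r i) ^ s) • μ.map (f i))
    (hfront : μ (frontier O) = 0) :
    sSup {t : ℝ≥0∞ | ∃ x ∈ E, ∃ d : ℝ, 0 < d ∧ t = sdens μ s x d} =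
    sSup {t : ℝ≥0∞ | ∃ x ∈ E, ∃ d : ℝ, 0 < d ∧ Metric.closedBall x d ⊆ O ∧
      t = sdens μ s x d} := by
  refine le_antisymm (sSup_le ?_) (sSup_le_sSup ?_)
  · rintro _ ⟨x, hx, d, hd, rfl⟩
    obtain ⟨z, hzO, hzE⟩ := hOE
    obtain ⟨ε, hε, hball⟩ := Metric.isOpen_iff.1 hOopen z hzO
    have : Nonempty (Fin m) := ⟨⟨0, by omega⟩⟩
    obtain ⟨j, hj⟩ := Finite.exists_max r
    have hDd : 0 < d + Metric.diam E := add_pos_of_pos_of_nonneg hd Metric.diam_nonneg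
    obtain ⟨k, hk⟩ := exists_pow_lt_of_lt_one (div_pos hε hDd) (hr j).2
    obtain ⟨g, ρ, hρ, hρR, hg, hgE, ⟨y, hy, hyz⟩, hdens⟩ :=
      exists_small_copy_sdens_le (fun i => (hr i).1) hsim hEattr hinv hj k z hzE
    have hlt : ρ * (d + Metric.diam E) < ε := (lt_div_iff₀ hDd).1 (hρR.trans_lt hk)
    refine (hdens x d hd).trans
      (le_sSup ⟨g x, hgE hx, ρ * d, mul_pos hρ hd, fun p hp => hball ?_, rfl⟩)
    have hdist : dist x y ≤ Metric.diam E :=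
      Metric.dist_le_diam_of_mem hEcomp.isBounded hx hy
    calc dist p z ≤ dist p (g x) + dist (g x) z := dist_triangle _ _ _
      _ ≤ ρ * d + ρ * Metric.diam E := by
        rw [← hyz, hg]
        exact add_le_add hp (mul_le_mul_of_nonneg_left hdist hρ.le)
      _ = ρ * (d + Metric.diam E) := by ring
      _ < ε := hlt
  · rintro t ⟨x, hx, d, hd, -, rfl⟩
    exact ⟨x, hx, d, hd, rfl⟩
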